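/- Let β ≠ 0, M ≥ N ≥ 1, and let u₁,…,u_N be nonzero complex numbers with u_j² ≠ u_k² for j ≠ k and u_j² ≠ −β for all j. Then for any 1 ≤ x₁ < ⋯ < x_N ≤ M, the wavefunctions of the integrable five-vertex model satisfy ⟨x₁⋯x_N|ψ({u}_N)⟩ = (−β⁻¹)^{N(N−1)/2} ∏_{j=1}^N u_j^{M−1} G_λ(z;β) and ⟨ψ({u}_N)|x₁⋯x_N⟩ = (−β⁻¹)^{N(N−1)/2} ∏_{j=1}^N u_j^{M−1} G_{λ∨}(z;β), where z_j = −β⁻¹ − u_j⁻², λ_j = x_{N−j+1} − N + j − 1, and λ∨_j = M − N + j − x_j. -/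

import Mathlib

noncomputable section

/-- The pair `(a,b)` of qubit indices as an index in `Fin 4` (basis order `|00⟩,|01⟩,|10⟩,|11⟩`). -/
def pidx (p : Fin 2 × Fin 2) : Fin 4 :=
  ⟨2 * p.1.val + p.2.val, by have := p.1.isLt; have := p.2.isLt; omega⟩

/-- Reindex a `4 × 4` matrix as a matrix on `ℂ² ⊗ ℂ²` (auxiliary factor first). -/
def toPair (A : Matrix (Fin 4) (Fin 4) ℂ) : Matrix (Fin 2 × Fin 2) (Fin 2 × Fin 2) ℂ :=
  Matrix.of fun p q => A (pidx p) (pidx q)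

/-- `L_{aj}`: a (possibly site-dependent) two-site operator acting on the auxiliary space
and the `j`-th site of the quantum space `V^{⊗M}`, identity elsewhere. -/
def siteOp (M : ℕ) (Lm : Fin M → Matrix (Fin 2 × Fin 2) (Fin 2 × Fin 2) ℂ) (j : Fin M) :
    Matrix (Fin 2 × (Fin M → Fin 2)) (Fin 2 × (Fin M → Fin 2)) ℂ :=
  Matrix.of fun s t =>
    Lm j (s.1, s.2 j) (t.1, t.2 j) * (if ∀ i, i ≠ j → s.2 i = t.2 i then 1 else 0)

/-- The monodromy matrix `T_a = L_{aM} ⋯ L_{a1}`. -/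
def monodromy (M : ℕ) (Lm : Fin M → Matrix (Fin 2 × Fin 2) (Fin 2 × Fin 2) ℂ) :
    Matrix (Fin 2 × (Fin M → Fin 2)) (Fin 2 × (Fin M → Fin 2)) ℂ :=
  ((List.ofFn fun j : Fin M => siteOp M Lm j).reverse).prod

/-- The operator `B` on `V^{⊗M}`: the upper-right block `⟨0|_a T_a |1⟩_a` of the monodromy. -/
def Bop (M : ℕ) (Lm : Fin M → Matrix (Fin 2 × Fin 2) (Fin 2 × Fin 2) ℂ) :
    Matrix (Fin M → Fin 2) (Fin M → Fin 2) ℂ :=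
  Matrix.of fun s t => monodromy M Lm (0, s) (1, t)

/-- The configuration of `V^{⊗M}` with particles (`|1⟩`) at the positions `x` and
`|0⟩` elsewhere. -/
def conf {M N : ℕ} (x : Fin N → Fin M) : Fin M → Fin 2 :=
  fun i => if ∃ j, x j = i then 1 else 0

/-- The operator `C` on `V^{⊗M}`: the lower-left block `⟨1|_a T_a |0⟩_a` of the monodromy. -/
def Cop (M : ℕ) (Lm : Fin M → Matrix (Fin 2 × Fin 2) (Fin 2 × Fin 2) ℂ) :
    Matrix (Fin M → Fin 2) (Fin M → Fin 2) ℂ :=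
  Matrix.of fun s t => monodromy M Lm (1, s) (0, t)

/-- The integrable five-vertex L-operator (the `q = 0` limit of the `β`-deformed model). -/
def Lfive (β u : ℂ) : Matrix (Fin 2 × Fin 2) (Fin 2 × Fin 2) ℂ :=
  toPair !![u, 0, 0, 0;
            0, 0, 1, 0;
            0, 1, -β⁻¹ * u - u⁻¹, 0;
            0, 0, 0, -β⁻¹ * u]

/-- The Grothendieck polynomial of the Grassmannian variety,
`G_λ(z;β) = det( z_j^{λ_k+N−k} (1+βz_j)^{k−1} ) / ∏_{j<k} (z_j − z_k)`. -/
def Groth (N : ℕ) (β : ℂ) (lam : Fin N → ℕ) (z : Fin N → ℂ) : ℂ :=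
  Matrix.det (Matrix.of fun j k : Fin N =>
      z j ^ (lam k + (N - 1 - (k : ℕ))) * (1 + β * z j) ^ (k : ℕ))
    / ∏ j : Fin N, ∏ k : Fin N, if j < k then z j - z k else 1

open Matrix

/-- Append a site carrying the identity on the right end of the chain. -/
def siteExtend (M : ℕ) :
    Matrix (Fin 2 × (Fin M → Fin 2)) (Fin 2 × (Fin M → Fin 2)) ℂ →*
      Matrix (Fin 2 × (Fin (M + 1) → Fin 2)) (Fin 2 × (Fin (M + 1) → Fin 2)) ℂ where
  toFun X := of fun s t =>
    X (s.1, Fin.init s.2) (t.1, Fin.init t.2) *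
      if s.2 (Fin.last M) = t.2 (Fin.last M) then 1 else 0
  map_one' := by
    ext ⟨a, s⟩ ⟨b, t⟩
    induction s using Fin.snocCases with
    | snoc s p =>
      induction t using Fin.snocCases with
      | snoc t q =>
        simp only [of_apply, Fin.init_snoc, Fin.snoc_last, one_apply, Prod.mk.injEq,
          Fin.snoc_inj]
        split_ifs <;> simp_all
  map_mul' X Y := by
    ext ⟨a, s⟩ ⟨b, t⟩
    simp only [of_apply, mul_apply, Fintype.sum_prod_type]
    rw [Finset.sum_mul]
    refine Finset.sum_congr rfl fun c _ => ?_
    rw [← (Fin.snocEquiv fun _ : Fin (M + 1) => Fin 2).sum_comp, Fintype.sum_prod_type]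
    simp only [Fin.snocEquiv, Equiv.coe_fn_mk, Fin.init_snoc, Fin.snoc_last]
    rw [Finset.sum_comm, Finset.sum_mul]
    refine Finset.sum_congr rfl fun r _ => ?_
    rw [Finset.sum_eq_single (s (Fin.last M))]
    · simp only [if_true]; ring
    · intro q _ hq
      simp [Ne.symm hq]
    · simp

theorem siteExtend_siteOp (M : ℕ) (Lm : Fin (M + 1) → Matrix (Fin 2 × Fin 2) (Fin 2 × Fin 2) ℂ)
    (j : Fin M) :
    siteExtend M (siteOp M (fun i => Lm i.castSucc) j) = siteOp (M + 1) Lm j.castSucc := by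
  ext ⟨a, s⟩ ⟨b, t⟩
  simp only [siteExtend, siteOp, MonoidHom.coe_mk, OneHom.coe_mk, of_apply, Fin.forall_fin_succ',
    Fin.init, mul_assoc]
  congr 1
  have h : Fin.last M ≠ j.castSucc := (Fin.castSucc_lt_last j).ne'
  simp only [ne_eq, Fin.castSucc_inj, h, not_false_eq_true, true_imp_iff,
    mul_ite, mul_one, mul_zero, and_comm, ite_and]
  congr

theorem monodromy_succ (M : ℕ) (Lm : Fin (M + 1) → Matrix (Fin 2 × Fin 2) (Fin 2 × Fin 2) ℂ)
    (a b : Fin 2) (s t : Fin (M + 1) → Fin 2) :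
    monodromy (M + 1) Lm (a, s) (b, t) =
      ∑ c, Lm (Fin.last M) (a, s (Fin.last M)) (c, t (Fin.last M)) *
        monodromy M (fun i => Lm i.castSucc) (c, Fin.init s) (b, Fin.init t) := by
  have h : monodromy (M + 1) Lm = siteOp (M + 1) Lm (Fin.last M) *
      siteExtend M (monodromy M fun i => Lm i.castSucc) := by
    rw [monodromy, monodromy, map_list_prod, List.map_reverse, List.map_ofFn, List.ofFn_succ',
      List.concat_eq_append, List.reverse_append]
    simp only [List.reverse_singleton, List.singleton_append, List.prod_cons]
    congr 4
    funext j
    exact (siteExtend_siteOp M Lm j).symm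
  rw [h, mul_apply, Fintype.sum_prod_type]
  refine Finset.sum_congr rfl fun c _ => ?_
  rw [Finset.sum_eq_single (Fin.snoc (Fin.init s) (t (Fin.last M)) : Fin (M + 1) → Fin 2)]
  · simp [siteOp, siteExtend, Fin.forall_fin_succ', Fin.init, (Fin.castSucc_lt_last _).ne]
  · intro r _ hr
    simp only [siteOp, siteExtend, MonoidHom.coe_mk, OneHom.coe_mk, of_apply]
    by_cases h1 : r (Fin.last M) = t (Fin.last M)
    · have : ¬ ∀ i, i ≠ Fin.last M → s i = r i := by
        intro hs
        apply hr
        rw [← Fin.snoc_init_self r, h1]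
        congr 1
        funext i
        exact (hs i.castSucc (Fin.castSucc_lt_last _).ne).symm
      rw [if_neg this]; simp
    · simp [h1]
  · simp

/-- The number of particles of a configuration. -/
def particleCount {M : ℕ} (t : Fin M → Fin 2) : ℕ := ∑ i, (t i : ℕ)

theorem particleCount_succ {M : ℕ} (t : Fin (M + 1) → Fin 2) :
    particleCount t = particleCount (Fin.init t) + t (Fin.last M) := by
  simp [particleCount, Fin.sum_univ_castSucc, Fin.init]

theorem Lfive_conserve (β u : ℂ) (a p c q : Fin 2) (h : (a : ℕ) + p ≠ c + q) :
    Lfive β u (a, p) (c, q) = 0 := by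
  fin_cases a <;> fin_cases p <;> fin_cases c <;> fin_cases q <;>
    simp [Lfive, toPair, pidx] at h ⊢

theorem monodromy_conserve (β u : ℂ) (M : ℕ) (a b : Fin 2) (s t : Fin M → Fin 2)
    (h : (a : ℕ) + particleCount s ≠ b + particleCount t) :
    monodromy M (fun _ => Lfive β u) (a, s) (b, t) = 0 := by
  induction M generalizing a with
  | zero =>
    simp only [particleCount, Finset.univ_eq_empty, Finset.sum_empty, add_zero] at h
    simp [monodromy, one_apply, show a ≠ b from fun e => h (by rw [e])]
  | succ M ih =>
    rw [monodromy_succ]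
    refine Finset.sum_eq_zero fun c _ => ?_
    rw [particleCount_succ, particleCount_succ t] at h
    by_cases hc : (c : ℕ) + particleCount (Fin.init s) = b + particleCount (Fin.init t)
    · rw [Lfive_conserve, zero_mul]
      omega
    · rw [ih _ _ _ hc, mul_zero]

/-- The product over the particles of `t` of `f k i`, for the `k`-th particle sitting at `i`. -/
def particleProd (f : ℕ → ℕ → ℂ) : (M : ℕ) → (Fin M → Fin 2) → ℂ
  | 0, _ => 1
  | M + 1, t => particleProd f M (Fin.init t) *
      if t (Fin.last M) = 1 then f (particleCount (Fin.init t)) M else 1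

/-- The monodromy (entering in the auxiliary state `|1⟩`) applied to `particleProd f`. -/
def rowSum (β u : ℂ) (f : ℕ → ℕ → ℂ) (M : ℕ) (a : Fin 2) (s : Fin M → Fin 2) : ℂ :=
  ∑ t, monodromy M (fun _ => Lfive β u) (a, s) (1, t) * particleProd f M t

theorem rowSum_succ (β u : ℂ) (f : ℕ → ℕ → ℂ) (M : ℕ) (a : Fin 2) (s : Fin (M + 1) → Fin 2) :
    rowSum β u f (M + 1) a s = ∑ c, rowSum β u f M c (Fin.init s) *
      ∑ q, Lfive β u (a, s (Fin.last M)) (c, q) *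
        if q = 1 then f (c + particleCount (Fin.init s) - 1) M else 1 := by
  simp only [rowSum, monodromy_succ]
  rw [← (Fin.snocEquiv fun _ : Fin (M + 1) => Fin 2).sum_comp, Fintype.sum_prod_type]
  simp only [Fin.snocEquiv, Equiv.coe_fn_mk, Fin.init_snoc, Fin.snoc_last, particleProd,
    Finset.sum_mul, Finset.mul_sum]
  conv_lhs =>
    enter [2, q]
    rw [Finset.sum_comm]
  rw [Finset.sum_comm]
  refine Finset.sum_congr rfl fun c _ => ?_
  refine Finset.sum_congr rfl fun q _ => Finset.sum_congr rfl fun t _ => ?_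
  by_cases h : (c : ℕ) + particleCount (Fin.init s) = 1 + particleCount t
  · rw [h, Nat.add_sub_cancel_left]; ring
  · rw [monodromy_conserve β u M c 1 _ _ h]; ring

/-- `x 0 < ⋯ < x (n - 1)` are positions in a chain of `M` sites. -/
def IsPositions (M n : ℕ) (x : ℕ → ℕ) : Prop :=
  (∀ i j, i < j → j < n → x i < x j) ∧ ∀ k < n, x k < M

/-- The configuration of `M` sites with particles at `x 0, …, x (n - 1)`. -/
def seqConf (M n : ℕ) (x : ℕ → ℕ) : Fin M → Fin 2 :=
  fun i => open Classical in if ∃ k < n, x k = i then 1 else 0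

theorem seqConf_last_eq_zero {M n : ℕ} {x : ℕ → ℕ} (h : IsPositions M n x) :
    seqConf (M + 1) n x (Fin.last M) = 0 := by
  refine if_neg ?_
  rintro ⟨k, hk, e⟩
  exact (h.2 k hk).ne e

theorem seqConf_init_of_last {M n : ℕ} {x : ℕ → ℕ} (hx : x n = M) :
    Fin.init (seqConf (M + 1) (n + 1) x) = seqConf M n x := by
  funext i
  have : (∃ k < n + 1, x k = i) ↔ ∃ k < n, x k = i := by
    constructor
    · rintro ⟨k, hk, e⟩
      refine ⟨k, lt_of_le_of_ne (Nat.lt_succ_iff.1 hk) ?_, e⟩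
      rintro rfl
      exact i.isLt.ne (e.symm.trans hx)
    · rintro ⟨k, hk, e⟩
      exact ⟨k, hk.trans (Nat.lt_succ_self n), e⟩
  simp only [Fin.init, seqConf, Fin.val_castSucc, this]

theorem seqConf_last_eq_one {M n : ℕ} {x : ℕ → ℕ} (hx : x n = M) :
    seqConf (M + 1) (n + 1) x (Fin.last M) = 1 :=
  if_pos ⟨n, Nat.lt_succ_self n, hx⟩

theorem IsPositions.cases {M n : ℕ} {x : ℕ → ℕ} (h : IsPositions (M + 1) n x) :
    IsPositions M n x ∨ ∃ m, n = m + 1 ∧ x m = M ∧ IsPositions M m x := by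
  rcases n with _ | m
  · exact .inl ⟨h.1, by simp⟩
  · have hm := h.2 m (Nat.lt_succ_self m)
    have hlt : ∀ k < m, x k < x m := fun k hk => h.1 k m hk (Nat.lt_succ_self m)
    by_cases e : x m = M
    · refine .inr ⟨m, rfl, e, fun i j hij hj => h.1 i j hij (by omega), fun k hk => ?_⟩
      exact e ▸ hlt k hk
    · refine .inl ⟨h.1, fun k hk => ?_⟩
      rcases Nat.lt_succ_iff_lt_or_eq.1 hk with hk | rfl
      · have := hlt k hk
        omega
      · omega

theorem particleCount_seqConf {M n : ℕ} {x : ℕ → ℕ} (h : IsPositions M n x) :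
    particleCount (seqConf M n x) = n := by
  induction M generalizing n with
  | zero =>
    rcases n with _ | n
    · simp [particleCount]
    · exact absurd (h.2 0 n.succ_pos) (Nat.not_lt_zero _)
  | succ M ih =>
    rw [particleCount_succ]
    rcases h.cases with h | ⟨m, rfl, e, h⟩
    · rw [seqConf_last_eq_zero h]
      exact ih h
    · rw [seqConf_last_eq_one e, seqConf_init_of_last e, ih h]
      rfl

theorem particleProd_seqConf (f : ℕ → ℕ → ℂ) {M n : ℕ} {x : ℕ → ℕ} (h : IsPositions M n x) :
    particleProd f M (seqConf M n x) = ∏ k ∈ Finset.range n, f k (x k) := by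
  induction M generalizing n with
  | zero =>
    rcases n with _ | n
    · simp [particleProd]
    · exact absurd (h.2 0 n.succ_pos) (Nat.not_lt_zero _)
  | succ M ih =>
    rw [particleProd]
    rcases h.cases with h | ⟨m, rfl, e, h⟩
    · rw [seqConf_last_eq_zero h, ← ih h]
      exact mul_one _
    · rw [seqConf_last_eq_one e, seqConf_init_of_last e, ih h, if_pos rfl,
        particleCount_seqConf h, Finset.prod_range_succ, e]

theorem exists_eq_seqConf {M : ℕ} (t : Fin M → Fin 2) :
    ∃ x, IsPositions M (particleCount t) x ∧ t = seqConf M (particleCount t) x := by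
  induction M with
  | zero => exact ⟨id, ⟨by simp [particleCount], by simp [particleCount]⟩, Subsingleton.elim _ _⟩
  | succ M ih =>
    obtain ⟨x, h, e⟩ := ih (Fin.init t)
    set n := particleCount (Fin.init t) with hn
    rcases Fin.exists_fin_two.1 ⟨t (Fin.last M), rfl⟩ with h0 | h1
    · have hc : particleCount t = n := by rw [particleCount_succ, h0]; rfl
      rw [hc]
      refine ⟨x, ⟨h.1, fun k hk => (h.2 k hk).trans (Nat.lt_succ_self M)⟩, ?_⟩
      rw [← Fin.snoc_init_self t, ← Fin.snoc_init_self (seqConf _ _ _), seqConf_last_eq_zero h, e,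
        h0]
      rfl
    · have hc : particleCount t = n + 1 := by rw [particleCount_succ, h1]; rfl
      rw [hc]
      have hu : Function.update x n M n = M := Function.update_self ..
      have hne : ∀ k < n, Function.update x n M k = x k :=
        fun k hk => Function.update_of_ne hk.ne _ _
      refine ⟨Function.update x n M, ⟨fun i j hij hj => ?_, fun k hk => ?_⟩, ?_⟩
      · rw [hne i (by omega)]
        rcases Nat.lt_succ_iff_lt_or_eq.1 hj with hj | rfl
        · rw [hne j hj]
          exact h.1 i j hij hj
        · rw [hu]
          exact h.2 i hij
      · rcases Nat.lt_succ_iff_lt_or_eq.1 hk with hk | rfl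
        · rw [hne k hk]
          exact (h.2 k hk).trans (Nat.lt_succ_self M)
        · rw [hu]
          exact Nat.lt_succ_self M
      · rw [← Fin.snoc_init_self t, ← Fin.snoc_init_self (seqConf _ _ _), seqConf_last_eq_one hu,
          seqConf_init_of_last hu, h1, e]
        congr 1
        funext i
        have : (∃ k < n, x k = i) ↔ ∃ k < n, Function.update x n M k = i :=
          exists_congr fun k => and_congr_right fun hk => by rw [hne k hk]
        simp only [seqConf, this]

/-- Total weight of moving a particle into `[a, b)`, the target `y` carrying the factor `f y`. -/
def hopSum (β u z : ℂ) (f : ℕ → ℂ) (a b : ℕ) : ℂ :=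
  ∑ y ∈ Finset.Ico a b, z ^ (b - 1 - y) * (if y = a then -β⁻¹ else (u⁻¹) ^ 2) * f y

theorem hopSum_succ_self (β u z : ℂ) (f : ℕ → ℂ) (a : ℕ) :
    hopSum β u z f a (a + 1) = -β⁻¹ * f a := by
  simp [hopSum]

theorem hopSum_succ (β u z : ℂ) (f : ℕ → ℂ) {a b : ℕ} (h : a < b) :
    hopSum β u z f a (b + 1) = z * hopSum β u z f a b + (u⁻¹) ^ 2 * f b := by
  rw [hopSum, Finset.sum_Ico_succ_top h.le, if_neg h.ne', hopSum, Finset.mul_sum]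
  congr 1
  · refine Finset.sum_congr rfl fun y hy => ?_
    rw [show b + 1 - 1 - y = b - 1 - y + 1 by have := Finset.mem_Ico.1 hy; omega]
    ring
  · simp

/-- Product of hopping weights, the rightmost particle being bounded by `m`. -/
def hopProd (β u z : ℂ) (f : ℕ → ℕ → ℂ) (x : ℕ → ℕ) : ℕ → ℕ → ℂ
  | 0, m => z ^ m
  | n + 1, m => hopProd β u z f x n (x n) * hopSum β u z (f n) (x n) m

theorem rowSum_seqConf {β u z : ℂ} (hu : u ≠ 0) (hz : z = -β⁻¹ - (u⁻¹) ^ 2) (f : ℕ → ℕ → ℂ)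
    {M n : ℕ} {x : ℕ → ℕ} (h : IsPositions M n x) :
    rowSum β u f M 1 (seqConf M n x) = u ^ M * hopProd β u z f x n M ∧
      rowSum β u f M 0 (seqConf M n x) * u =
        if n = 0 then 0 else u ^ M * hopProd β u z f x (n - 1) (x (n - 1)) := by
  have huz : -(β⁻¹ * u) - u⁻¹ = u * z := by rw [hz]; field_simp
  induction M generalizing n with
  | zero =>
    rcases n with _ | n
    · simp [rowSum, monodromy, hopProd, particleProd, one_apply]
      exact Subsingleton.elim _ _
    · exact absurd (h.2 0 n.succ_pos) (Nat.not_lt_zero _)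
  | succ M ih =>
    rw [rowSum_succ, rowSum_succ]
    rcases h.cases with h | ⟨m, rfl, e, h⟩
    · rw [seqConf_last_eq_zero h, show Fin.init (seqConf (M + 1) n x) = seqConf M n x from rfl,
        particleCount_seqConf h]
      obtain ⟨h1, h0⟩ := ih h
      simp only [Fin.sum_univ_two, h1, Lfive, toPair, pidx]
      simp
      rw [huz]
      rcases n with _ | n
      · simp [hopProd] at h0 ⊢
        rcases h0 with h0 | h0
        · rw [h0]
          exact ⟨by ring, .inl rfl⟩
        · exact absurd h0 hu
      · simp only [Nat.add_eq_zero_iff, one_ne_zero, and_false, if_false,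
          Nat.add_sub_cancel] at h0 ⊢
        refine ⟨?_, ?_⟩
        · rw [hopProd, hopProd, hopSum_succ _ _ _ _ (h.2 n (Nat.lt_succ_self n)), eq_div_of_mul_eq hu h0]
          field_simp
          ring
        · rw [h0]
          ring
    · rw [seqConf_last_eq_one e, seqConf_init_of_last e, particleCount_seqConf h]
      obtain ⟨h1, -⟩ := ih h
      simp only [Fin.sum_univ_two, h1, Lfive, toPair, pidx]
      simp [hopProd, e, hopSum_succ_self]
      constructor <;> ring

theorem hopProd_eq (β u z : ℂ) (f : ℕ → ℕ → ℂ) (x : ℕ → ℕ) (n : ℕ) :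
    hopProd β u z f x n (x n) =
      z ^ x 0 * ∏ k ∈ Finset.range n, hopSum β u z (f k) (x k) (x (k + 1)) := by
  induction n with
  | zero => simp [hopProd]
  | succ n ih => rw [hopProd, ih, Finset.prod_range_succ, mul_assoc]

theorem hopSum_pow {β u s : ℂ} (hβ : β ≠ 0) (hs : s = -β⁻¹ - (u⁻¹) ^ 2) (t w : ℂ) {a b : ℕ}
    (h : a < b) :
    (t - s) * hopSum β u s (fun y => t ^ y * w) a b =
      -β⁻¹ * ((1 + β * s) * t ^ b - s ^ (b - a) * (1 + β * t) * t ^ a) * w := by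
  have hc : (u⁻¹) ^ 2 = -β⁻¹ * (1 + β * s) := by
    rw [hs]; field_simp; ring
  induction b, h using Nat.le_induction with
  | base =>
    rw [hopSum_succ_self, Nat.succ_sub (le_refl a), Nat.sub_self, pow_succ, pow_succ]
    ring
  | succ b hb ih =>
    rw [hopSum_succ _ _ _ _ hb, mul_add, mul_left_comm, ih, hc,
      Nat.succ_sub (Nat.le_of_succ_le hb), pow_succ, pow_succ]
    ring

/-- The matrix in the numerator of the Grothendieck polynomial, with columns in increasing order
of the positions `x`. -/
def waveMatrix (β : ℂ) (N : ℕ) (z : Fin N → ℂ) (x : ℕ → ℕ) : Matrix (Fin N) (Fin N) ℂ :=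
  of fun j k => z j ^ x k * (1 + β * z j) ^ (N - 1 - (k : ℕ))

theorem det_waveMatrix_succ {β u : ℂ} (hβ : β ≠ 0) {N : ℕ} (z : Fin (N + 1) → ℂ)
    (hz : z 0 = -β⁻¹ - (u⁻¹) ^ 2) (h0 : 1 + β * z 0 ≠ 0) (x : ℕ → ℕ)
    (hx : ∀ k < N, x k < x (k + 1)) :
    (waveMatrix β (N + 1) z x).det = z 0 ^ x 0 * ((∏ j : Fin N, (z j.succ - z 0)) * (-β) ^ N *
      det (of fun j k : Fin N => hopSum β u (z 0)
        (fun y => z j.succ ^ y * (1 + β * z j.succ) ^ (N - 1 - (k : ℕ))) (x k) (x (k + 1)))) := by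
  set A := waveMatrix β (N + 1) z x with hA
  set c : Fin N → ℂ := fun k => z 0 ^ (x (k + 1) - x k) / (1 + β * z 0) with hc
  set H : Matrix (Fin N) (Fin N) ℂ := of fun j k : Fin N => hopSum β u (z 0)
    (fun y => z j.succ ^ y * (1 + β * z j.succ) ^ (N - 1 - (k : ℕ))) (x k) (x (k + 1)) with hH
  let B : Matrix (Fin (N + 1)) (Fin (N + 1)) ℂ := of fun j k =>
    Fin.cases (A j 0) (fun k => A j k.succ - c k * A j k.castSucc) k
  have hexp : ∀ k : Fin N, N + 1 - 1 - (k : ℕ) = N - 1 - (k : ℕ) + 1 ∧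
      N + 1 - 1 - ((k : ℕ) + 1) = N - 1 - (k : ℕ) := fun k => by
    have := k.isLt
    omega
  have hAB : A.det = B.det :=
    det_eq_of_forall_col_eq_smul_add_pred c (fun _ => rfl) fun i j => by simp [B]
  have hB0 : ∀ k : Fin N, B 0 k.succ = 0 := fun k => by
    have hk := (hx k k.isLt).le
    simp only [B, hA, hc, waveMatrix, of_apply, Fin.cases_succ, Fin.val_succ, Fin.val_castSucc,
      (hexp k).1, (hexp k).2]
    nth_rewrite 1 [← Nat.sub_add_cancel hk]
    field_simp
    ring
  have hBs : B.submatrix Fin.succ Fin.succ =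
      of fun j k => ((z j.succ - z 0) * (-β / (1 + β * z 0))) * H j k := by
    ext j k
    have hk := hopSum_pow hβ hz (z j.succ) ((1 + β * z j.succ) ^ (N - 1 - (k : ℕ))) (hx k k.isLt)
    rw [of_apply, mul_right_comm, hH, of_apply, hk]
    simp only [submatrix_apply, B, hA, hc, waveMatrix, of_apply, Fin.cases_succ, Fin.val_succ,
      Fin.val_castSucc, (hexp k).1, (hexp k).2]
    field_simp
    ring
  rw [hAB, det_succ_row_zero, Fin.sum_univ_succ]
  simp only [hB0, mul_zero, zero_mul, Finset.sum_const_zero, add_zero, Fin.succAbove_zero, hBs]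
  rw [det_mul_column, Finset.prod_mul_distrib, Finset.prod_const, Finset.card_univ,
    Fintype.card_fin]
  simp only [B, hA, waveMatrix, of_apply, Fin.cases_zero, Fin.val_zero, pow_zero, one_mul,
    Nat.sub_zero, Nat.add_sub_cancel, div_pow]
  field_simp

theorem det_vandermonde_succ {N : ℕ} (z : Fin (N + 1) → ℂ) :
    (vandermonde z).det =
      (∏ j : Fin N, (z j.succ - z 0)) * (vandermonde fun j : Fin N => z j.succ).det := by
  rw [det_vandermonde, Fin.prod_univ_succ, Fin.prod_Ioi_zero, det_vandermonde]
  simp only [Fin.prod_Ioi_succ]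

theorem triangle_succ (N : ℕ) : (N + 1) * (N + 1 - 1) / 2 = N * (N - 1) / 2 + N := by
  rw [← Finset.sum_range_id_mul_two, ← Finset.sum_range_id_mul_two, Finset.sum_range_succ]
  simp

theorem Bop_prod_seqConf {β : ℂ} (hβ : β ≠ 0) {M N : ℕ} (u z : Fin N → ℂ) (hu0 : ∀ j, u j ≠ 0)
    (hz : ∀ j, z j = -β⁻¹ - ((u j)⁻¹) ^ 2) (hinj : Function.Injective z)
    {x : ℕ → ℕ} (h : IsPositions M N x) :
    (List.ofFn fun j : Fin N => Bop M (fun _ => Lfive β (u j))).prod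
        (seqConf M N x) (fun _ => 0) =
      (-β⁻¹) ^ (N * (N - 1) / 2) * (∏ j, (u j) ^ (M - 1)) *
        ((waveMatrix β N z x).det / (vandermonde z).det) := by
  induction N generalizing x with
  | zero =>
    have : seqConf M 0 x = fun _ => 0 := by funext i; simp [seqConf]
    simp [this]
  | succ N ih =>
    have hM : 1 ≤ M := (Nat.zero_le _).trans_lt (h.2 0 N.succ_pos)
    have hs : Function.Injective fun j : Fin N => z j.succ :=
      hinj.comp (Fin.succ_injective N)
    have hV : (vandermonde fun j : Fin N => z j.succ).det ≠ 0 := det_vandermonde_ne_zero_iff.2 hs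
    have hP : ∏ j : Fin N, (z j.succ - z 0) ≠ 0 :=
      Finset.prod_ne_zero_iff.2 fun j _ => sub_ne_zero.2 fun e => Fin.succ_ne_zero j (hinj e)
    have h1 : 1 + β * z 0 ≠ 0 := by
      have := hu0 0
      rw [hz, show 1 + β * (-β⁻¹ - ((u 0)⁻¹) ^ 2) = -(β * ((u 0)⁻¹) ^ 2) by field_simp; ring]
      exact neg_ne_zero.2 (mul_ne_zero hβ (pow_ne_zero 2 (inv_ne_zero this)))
    set K : ℂ := (-β⁻¹) ^ (N * (N - 1) / 2) * (∏ j : Fin N, (u j.succ) ^ (M - 1)) /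
      (vandermonde fun j : Fin N => z j.succ).det with hK
    let f : Equiv.Perm (Fin N) → ℕ → ℕ → ℂ := fun σ k y =>
      if hk : k < N then z (σ ⟨k, hk⟩).succ ^ y * (1 + β * z (σ ⟨k, hk⟩).succ) ^ (N - 1 - k) else 0
    have hterm : ∀ t : Fin M → Fin 2,
        Bop M (fun _ => Lfive β (u 0)) (seqConf M (N + 1) x) t *
          (List.ofFn fun j : Fin N => Bop M (fun _ => Lfive β (u j.succ))).prod t (fun _ => 0) =
        K * ∑ σ : Equiv.Perm (Fin N), ((Equiv.Perm.sign σ : ℤ) : ℂ) *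
          (monodromy M (fun _ => Lfive β (u 0)) (0, seqConf M (N + 1) x) (1, t) *
            particleProd (f σ) M t) := fun t => by
      by_cases hc : particleCount t = N
      · obtain ⟨y, hy, e⟩ := exists_eq_seqConf t
        rw [hc] at hy e
        rw [e, ih (fun j => u j.succ) (fun j => z j.succ) (fun j => hu0 _) (fun j => hz _) hs hy,
          det_apply', hK, Bop, of_apply, Finset.sum_div, Finset.mul_sum, Finset.mul_sum,
          Finset.mul_sum]
        refine Finset.sum_congr rfl fun σ _ => ?_
        rw [particleProd_seqConf _ hy, Finset.prod_range]
        simp only [f, waveMatrix, of_apply, Fin.is_lt, dite_true, Fin.eta]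
        ring
      · have hm := monodromy_conserve β (u 0) M 0 1 (seqConf M (N + 1) x) t
          (by rw [particleCount_seqConf h]; simp; omega)
        simp [Bop, hm]
    have hrow : ∀ σ, rowSum β (u 0) (f σ) M 0 (seqConf M (N + 1) x) =
        u 0 ^ (M - 1) * (z 0 ^ x 0 * ∏ k : Fin N, hopSum β (u 0) (z 0)
          (fun y => z (σ k).succ ^ y * (1 + β * z (σ k).succ) ^ (N - 1 - (k : ℕ)))
          (x k) (x (k + 1))) := fun σ => by
      have hr := (rowSum_seqConf (hu0 0) (hz 0) (f σ) h).2
      rw [if_neg N.succ_ne_zero, Nat.add_sub_cancel, hopProd_eq, Finset.prod_range] at hr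
      simp only [f, Fin.is_lt, dite_true, Fin.eta] at hr
      refine mul_right_cancel₀ (hu0 0) (hr.trans ?_)
      obtain ⟨m, rfl⟩ := Nat.exists_eq_add_of_le' hM
      rw [Nat.add_sub_cancel]
      ring
    rw [List.ofFn_succ, List.prod_cons, mul_apply]
    simp only [hterm]
    rw [← Finset.mul_sum, Finset.sum_comm]
    simp only [← Finset.mul_sum]
    change K * ∑ σ : Equiv.Perm (Fin N), ((Equiv.Perm.sign σ : ℤ) : ℂ) *
      rowSum β (u 0) (f σ) M 0 (seqConf M (N + 1) x) = _
    simp only [hrow]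
    rw [det_waveMatrix_succ hβ z (hz 0) h1 x fun k hk => h.1 k (k + 1) k.lt_succ_self (by omega),
      det_vandermonde_succ, det_apply', Fin.prod_univ_succ, hK, triangle_succ, pow_add]
    simp only [of_apply]
    have hβN : (-β⁻¹) ^ N * (-β) ^ N = 1 := by
      rw [← mul_pow, neg_mul_neg, inv_mul_cancel₀ hβ, one_pow]
    have hsum : ∀ (g : Equiv.Perm (Fin N) → ℂ) (a b : ℂ),
        ∑ σ : Equiv.Perm (Fin N), ((Equiv.Perm.sign σ : ℤ) : ℂ) * (a * (b * g σ)) =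
          a * b * ∑ σ : Equiv.Perm (Fin N), ((Equiv.Perm.sign σ : ℤ) : ℂ) * g σ := fun g a b => by
      rw [Finset.mul_sum]
      exact Finset.sum_congr rfl fun σ _ => by ring
    rw [hsum]
    generalize (∑ σ : Equiv.Perm (Fin N), ((Equiv.Perm.sign σ : ℤ) : ℂ) * _) = D
    generalize (vandermonde fun j : Fin N => z j.succ).det = V at hV
    generalize ∏ j : Fin N, (z j.succ - z 0) = Q at hP
    generalize (-β⁻¹) ^ N = b at hβN
    generalize (-β) ^ N = b' at hβN
    rw [div_mul_eq_mul_div, ← mul_div_assoc, div_eq_div_iff hV (mul_ne_zero hP hV)]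
    linear_combination (-(-β⁻¹) ^ (N * (N - 1) / 2) * (∏ j : Fin N, u j.succ ^ (M - 1)) *
      u 0 ^ (M - 1) * z 0 ^ x 0 * D * Q * V) * hβN

theorem prod_sub_eq_sign_mul_det_vandermonde {N : ℕ} (z : Fin N → ℂ) :
    (∏ j : Fin N, ∏ k : Fin N, if j < k then z j - z k else 1) =
      ((Equiv.Perm.sign (Fin.revPerm : Equiv.Perm (Fin N)) : ℤ) : ℂ) * (vandermonde z).det := by
  rw [← det_permute, show (vandermonde z).submatrix (Fin.revPerm : Equiv.Perm (Fin N)) id =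
    vandermonde fun j => z (Fin.rev j) from rfl, det_vandermonde]
  have h : ∀ i : Fin N, ∏ j ∈ Finset.Ioi i, (z j.rev - z i.rev) =
      ∏ j : Fin N, if i < j then z j.rev - z i.rev else 1 := fun i => by
    rw [← Finset.prod_filter]
    congr 1
    ext j
    simp
  simp only [h]
  rw [Finset.prod_comm, ← Equiv.prod_comp Fin.revPerm]
  refine Finset.prod_congr rfl fun j _ => ?_
  rw [← Equiv.prod_comp Fin.revPerm]
  refine Finset.prod_congr rfl fun k _ => ?_
  simp [Fin.rev_lt_rev]

theorem Groth_eq_det_div {β : ℂ} {N : ℕ} (lam : Fin N → ℕ) (z : Fin N → ℂ) (x : ℕ → ℕ)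
    (hx : ∀ k : Fin N, lam k + (N - 1 - (k : ℕ)) = x (Fin.rev k)) :
    Groth N β lam z = (waveMatrix β N z x).det / (vandermonde z).det := by
  have hW : (of fun j k : Fin N =>
      z j ^ (lam k + (N - 1 - (k : ℕ))) * (1 + β * z j) ^ (k : ℕ)) =
      (waveMatrix β N z x).submatrix id (Fin.revPerm : Equiv.Perm (Fin N)) := by
    ext j k
    have : N - 1 - ((Fin.rev k : Fin N) : ℕ) = k := by
      have := k.isLt
      rw [Fin.val_rev]
      omega
    simp only [waveMatrix, hx, submatrix_apply, of_apply, id, Fin.revPerm_apply, this]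
  rw [Groth, hW, det_permute', prod_sub_eq_sign_mul_det_vandermonde, mul_div_mul_left]
  exact Int.cast_ne_zero.2 (Units.ne_zero _)

theorem Groth_comp_perm {β : ℂ} {N : ℕ} (lam : Fin N → ℕ) (z : Fin N → ℂ)
    (σ : Equiv.Perm (Fin N)) : Groth N β lam (z ∘ σ) = Groth N β lam z := by
  have hV : (vandermonde (z ∘ σ)).det = ((Equiv.Perm.sign σ : ℤ) : ℂ) * (vandermonde z).det := by
    rw [← det_permute]
    rfl
  have hD : (of fun j k : Fin N => (z ∘ σ) j ^ (lam k + (N - 1 - (k : ℕ))) *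
      (1 + β * (z ∘ σ) j) ^ (k : ℕ)).det = ((Equiv.Perm.sign σ : ℤ) : ℂ) *
      (of fun j k : Fin N =>
        z j ^ (lam k + (N - 1 - (k : ℕ))) * (1 + β * z j) ^ (k : ℕ)).det := by
    rw [← det_permute]
    rfl
  rw [Groth, Groth, prod_sub_eq_sign_mul_det_vandermonde, prod_sub_eq_sign_mul_det_vandermonde, hV,
    hD, mul_left_comm, mul_div_mul_left]
  exact Int.cast_ne_zero.2 (Units.ne_zero _)

theorem Bop_prod_conf {β : ℂ} (hβ : β ≠ 0) {M N : ℕ} (u : Fin N → ℂ) (hu0 : ∀ j, u j ≠ 0)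
    (hsq : ∀ j k, j ≠ k → (u j) ^ 2 ≠ (u k) ^ 2) (x : Fin N → Fin M) (hx : StrictMono x) :
    (List.ofFn fun j : Fin N => Bop M (fun _ => Lfive β (u j))).prod (conf x) (fun _ => 0) =
      (-β⁻¹) ^ (N * (N - 1) / 2) * (∏ j, (u j) ^ (M - 1)) *
        Groth N β (fun j => (x (Fin.rev j) : ℕ) + 1 + (j : ℕ) - N)
          (fun j => -β⁻¹ - ((u j)⁻¹) ^ 2) := by
  let y : ℕ → ℕ := fun k => if hk : k < N then x ⟨k, hk⟩ else 0
  have hy : ∀ k : Fin N, y k = x k := fun k => by simp [y]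
  have hpos : IsPositions M N y := by
    refine ⟨fun i j hij hj => ?_, fun k hk => ?_⟩
    · simp only [y, hj, hij.trans hj, dite_true]
      exact hx hij
    · simp only [y, hk, dite_true, Fin.is_lt]
  have hconf : conf x = seqConf M N y := by
    funext i
    have : (∃ j, x j = i) ↔ ∃ k < N, y k = i := by
      constructor
      · rintro ⟨j, rfl⟩
        exact ⟨j, j.isLt, hy j⟩
      · rintro ⟨k, hk, e⟩
        exact ⟨⟨k, hk⟩, Fin.ext ((hy ⟨k, hk⟩).symm.trans e)⟩
    simp only [conf, seqConf, this]
  have hinj : Function.Injective fun j => -β⁻¹ - ((u j)⁻¹) ^ 2 := fun j k e => by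
    by_contra hne
    refine hsq j k hne ?_
    have e' := sub_right_inj.1 e
    rwa [inv_pow, inv_pow, _root_.inv_inj] at e'
  have hle : ∀ k : Fin N, (k : ℕ) ≤ x k := fun ⟨k, hk⟩ => by
    induction k with
    | zero => exact Nat.zero_le _
    | succ k ih => exact (ih (by omega)).trans_lt (hx (Nat.lt_succ_self k))
  rw [hconf, Bop_prod_seqConf hβ u _ hu0 (fun _ => rfl) hinj hpos, Groth_eq_det_div]
  intro k
  have := hle (Fin.rev k)
  have hk := k.isLt
  rw [hy]
  rw [Fin.val_rev] at this
  omega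

theorem Lfive_symm (β u : ℂ) (p q : Fin 2 × Fin 2) : Lfive β u p q = Lfive β u q p := by
  obtain ⟨a, b⟩ := p
  obtain ⟨c, d⟩ := q
  fin_cases a <;> fin_cases b <;> fin_cases c <;> fin_cases d <;> simp [Lfive, toPair, pidx]

/-- Reversal of the sites of a configuration. -/
def revConf (M : ℕ) : (Fin M → Fin 2) ≃ (Fin M → Fin 2) := Fin.revPerm.arrowCongr (Equiv.refl _)

theorem List.ofFn_rev {α : Type*} {n : ℕ} (f : Fin n → α) :
    List.ofFn (fun i => f (Fin.rev i)) = (List.ofFn f).reverse := by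
  refine List.ext_getElem (by simp) fun i h₁ h₂ => ?_
  simp only [List.getElem_ofFn, List.getElem_reverse, List.length_ofFn]
  congr 1
  ext
  simp only [Fin.val_rev]
  omega

theorem submatrix_list_prod {m : Type*} [Fintype m] [DecidableEq m] (e : m ≃ m)
    (l : List (Matrix m m ℂ)) :
    l.prod.submatrix e e = (l.map fun A => A.submatrix e e).prod := by
  exact map_list_prod (Matrix.reindexRingEquiv ℂ e.symm) l

theorem monodromy_reverse (β u : ℂ) (M : ℕ) (a b : Fin 2) (s t : Fin M → Fin 2) :
    monodromy M (fun _ => Lfive β u) (a, s) (b, t) =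
      monodromy M (fun _ => Lfive β u) (b, revConf M t) (a, revConf M s) := by
  let e : Fin 2 × (Fin M → Fin 2) ≃ Fin 2 × (Fin M → Fin 2) :=
    (Equiv.refl _).prodCongr (revConf M)
  have hsite : ∀ j, ((siteOp M (fun _ => Lfive β u) j).submatrix e e)ᵀ =
      siteOp M (fun _ => Lfive β u) (Fin.rev j) := fun j => by
    ext ⟨c, s⟩ ⟨d, t⟩
    simp only [transpose_apply, submatrix_apply, siteOp, of_apply]
    rw [Lfive_symm]
    congr 1
    refine if_congr ?_ rfl rfl
    rw [← Fin.revPerm.forall_congr_right]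
    refine forall_congr' fun i => ?_
    have hi : Fin.rev i = j ↔ i = Fin.rev j := Fin.rev_eq_iff
    simp [e, revConf, hi, eq_comm (a := s i)]
  have h : ((monodromy M (fun _ => Lfive β u)).submatrix e e)ᵀ =
      monodromy M (fun _ => Lfive β u) := by
    rw [monodromy, submatrix_list_prod, transpose_list_prod, List.map_map, List.map_reverse,
      List.reverse_reverse, List.map_ofFn, ← List.ofFn_rev]
    congr 2
    funext j
    exact hsite j
  conv_lhs => rw [← h]
  rfl

theorem Cop_prod_eq (β : ℂ) {M N : ℕ} (u : Fin N → ℂ) (s t : Fin M → Fin 2) :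
    (List.ofFn fun j : Fin N => Cop M (fun _ => Lfive β (u j))).prod s t =
      (List.ofFn fun j : Fin N => Bop M (fun _ => Lfive β (u (Fin.rev j)))).prod
        (revConf M t) (revConf M s) := by
  have hC : ∀ j, Cop M (fun _ => Lfive β (u j)) =
      ((Bop M (fun _ => Lfive β (u j))).submatrix (revConf M) (revConf M))ᵀ := fun j => by
    ext s t
    exact monodromy_reverse β (u j) M 1 0 s t
  have h : (List.ofFn fun j : Fin N => Cop M (fun _ => Lfive β (u j))).prod =
      ((List.ofFn fun j : Fin N => Bop M (fun _ => Lfive β (u (Fin.rev j)))).prod.submatrix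
        (revConf M) (revConf M))ᵀ := by
    rw [submatrix_list_prod, transpose_list_prod, List.map_map, List.map_ofFn, ← List.ofFn_rev]
    congr 2
    funext j
    simp [hC]
  rw [h]
  rfl

/-- The wavefunction and dual wavefunction of the integrable five-vertex
model are given by Grothendieck polynomials: `z_j = −β⁻¹ − u_j⁻²`,
`λ_j = x_{N−j+1} − N + j − 1` and `λ∨_j = M − N + j − x_j` (positions `1`-indexed:
`x_j = (x j : ℕ) + 1`). -/
theorem five_vertex_wavefunctions_grothendieck (β : ℂ) (hβ : β ≠ 0)
    (M N : ℕ) (hN : 1 ≤ N) (hMN : N ≤ M)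
    (u : Fin N → ℂ) (hu0 : ∀ j, u j ≠ 0)
    (hsq : ∀ j k, j ≠ k → (u j) ^ 2 ≠ (u k) ^ 2)
    (hβu : ∀ j, (u j) ^ 2 ≠ -β)
    (x : Fin N → Fin M) (hx : StrictMono x) :
    ((List.ofFn fun j : Fin N => Bop M (fun _ => Lfive β (u j))).prod)
        (conf x) (fun _ => 0)
      = (-β⁻¹) ^ (N * (N - 1) / 2) * (∏ j, (u j) ^ (M - 1))
        * Groth N β (fun j => (x (Fin.rev j) : ℕ) + 1 + (j : ℕ) - N)
            (fun j => -β⁻¹ - ((u j)⁻¹) ^ 2)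
    ∧
    ((List.ofFn fun j : Fin N => Cop M (fun _ => Lfive β (u j))).prod)
        (fun _ => 0) (conf x)
      = (-β⁻¹) ^ (N * (N - 1) / 2) * (∏ j, (u j) ^ (M - 1))
        * Groth N β (fun j => M - N + (j : ℕ) - (x j : ℕ))
            (fun j => -β⁻¹ - ((u j)⁻¹) ^ 2) := by
  refine ⟨Bop_prod_conf hβ u hu0 hsq x hx, ?_⟩
  have hx' : StrictMono fun j : Fin N => Fin.rev (x (Fin.rev j)) := fun i j hij =>
    Fin.rev_lt_rev.2 (hx (Fin.rev_lt_rev.2 hij))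
  have hconf : revConf M (conf x) = conf fun j : Fin N => Fin.rev (x (Fin.rev j)) := by
    funext i
    have : (∃ j, x j = Fin.rev i) ↔ ∃ j : Fin N, Fin.rev (x (Fin.rev j)) = i := by
      rw [← Fin.revPerm.exists_congr_right]
      simp [Fin.rev_eq_iff]
    simp [revConf, conf, this]
  rw [Cop_prod_eq, hconf, show revConf M (fun _ => 0) = fun _ => 0 from rfl,
    Bop_prod_conf hβ (fun j => u (Fin.rev j)) (fun j => hu0 _)
      (fun j k hjk => hsq _ _ (Fin.rev_injective.ne hjk)) _ hx',
    show ∏ j : Fin N, u (Fin.rev j) ^ (M - 1) = ∏ j, u j ^ (M - 1) from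
      Equiv.prod_comp Fin.revPerm fun j => u j ^ (M - 1)]
  congr 1
  rw [← Groth_comp_perm _ (fun j => -β⁻¹ - ((u j)⁻¹) ^ 2) Fin.revPerm]
  congr 1
  funext j
  have h1 := (x j).isLt
  rw [Fin.rev_rev, Fin.val_rev]
  omega
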